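/- Let a < b be real numbers and n ≥ 1 a natural number. Let μ be a finite signed measure on ℝ concentrated on (a,b] with distribution function F(x) = μ((a,x]) (so F(a) = 0), and define I₀ = F and I_k(x) = ∫_a^x I_{k−1}(t) dt for k ≥ 1. Then ∫_{[a,b]} f dμ ≥ 0 for every continuous n-convex function f : [a,b] → ℝ if and only if: (i) F(b) = 0; (ii) I₁(b) = 0; (iii) I_k(b) = 0 for every k = 2, …, n; and (iv) (−1)^{n+1} I_n(x) ≥ 0 for every x ∈ (a,b). -/

import Mathlib

open MeasureTheory Set

/-- Integral of `f` with respect to a finite signed measure `μ`,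
defined via the Jordan decomposition `μ = μ⁺ - μ⁻`. -/
noncomputable def sintegral (μ : SignedMeasure ℝ) (f : ℝ → ℝ) : ℝ :=
  (∫ x, f x ∂μ.toJordanDecomposition.posPart) - ∫ x, f x ∂μ.toJordanDecomposition.negPart

/-- Integral of `f` over a set `s` with respect to a finite signed measure `μ`. -/
noncomputable def sintegralOn (μ : SignedMeasure ℝ) (s : Set ℝ) (f : ℝ → ℝ) : ℝ :=
  (∫ x in s, f x ∂μ.toJordanDecomposition.posPart) - ∫ x in s, f x ∂μ.toJordanDecomposition.negPart

/-- A signed measure `μ` is concentrated on `s` if `|μ|(sᶜ) = 0`. -/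
def ConcentratedOn (μ : SignedMeasure ℝ) (s : Set ℝ) : Prop :=
  μ.totalVariation sᶜ = 0

/-- Iterated integrals based at `a`: `I₀ = F`, `I_{k+1}(x) = ∫_a^x I_k(t) dt`. -/
noncomputable def iterInt (a : ℝ) (F : ℝ → ℝ) : ℕ → ℝ → ℝ
  | 0 => F
  | k + 1 => fun x => ∫ t in a..x, iterInt a F k t

/-- `f` is `n`-convex on `(a,b)` (`n ≥ 1`): it is `(n-1)`-times differentiable on `(a,b)`
and its `(n-1)`-st derivative is convex on `(a,b)`. -/
def NConvexOn (n : ℕ) (a b : ℝ) (f : ℝ → ℝ) : Prop :=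
  ContDiffOn ℝ ((n - 1 : ℕ) : ℕ∞) f (Ioo a b) ∧
  ConvexOn ℝ (Ioo a b) (iteratedDerivWithin (n - 1) f (Ioo a b))

/-- The truncated power `(x - t)₊ ^ k`, with the convention `0 ^ 0 = 1` at `t = x`. -/
noncomputable def truncPow (k : ℕ) (x t : ℝ) : ℝ :=
  if t ≤ x then (x - t) ^ k else 0

lemma truncPow_of_le {k : ℕ} {x t : ℝ} (h : t ≤ x) : truncPow k x t = (x - t) ^ k := if_pos h

lemma truncPow_of_lt {k : ℕ} {x t : ℝ} (h : x < t) : truncPow k x t = 0 := if_neg h.not_ge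

lemma truncPow_succ_eq_max (k : ℕ) (x t : ℝ) :
    truncPow (k + 1) x t = max (x - t) 0 ^ (k + 1) := by
  rcases le_or_gt t x with h | h
  · rw [truncPow_of_le h, max_eq_left (by linarith)]
  · rw [truncPow_of_lt h, max_eq_right (by linarith), zero_pow (by simp)]

lemma measurable_truncPow_uncurry (k : ℕ) :
    Measurable fun z : ℝ × ℝ => truncPow k z.1 z.2 :=
  Measurable.ite (measurableSet_le measurable_snd measurable_fst) (by fun_prop) measurable_const

lemma measurable_truncPow (k : ℕ) (x : ℝ) : Measurable (truncPow k x) :=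
  (measurable_truncPow_uncurry k).comp measurable_prodMk_left

lemma abs_truncPow_le {k : ℕ} {a b x t : ℝ} (hx : x ≤ b) (ht : a ≤ t) (hab : a ≤ b) :
    |truncPow k x t| ≤ (b - a) ^ k := by
  rcases le_or_gt t x with h | h
  · rw [truncPow_of_le h, abs_of_nonneg (pow_nonneg (by linarith) k)]
    exact pow_le_pow_left₀ (by linarith) (by linarith) k
  · rw [truncPow_of_lt h, abs_zero]
    exact pow_nonneg (by linarith) k

lemma integral_mul_truncPow {k : ℕ} {a x t : ℝ} (w : ℝ → ℝ) (hat : a ≤ t) (htx : t ≤ x)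
    (hw : IntervalIntegrable w volume a x) :
    ∫ s in a..x, w s * truncPow k s t = ∫ s in t..x, w s * (s - t) ^ k := by
  have hzero : ∀ s ∈ Ioo a t, w s * truncPow k s t = 0 := fun s hs => by
    rw [truncPow_of_lt hs.2, mul_zero]
  have hleft : ∫ s in a..t, w s * truncPow k s t = 0 := by
    rw [intervalIntegral.integral_of_le hat, integral_Ioc_eq_integral_Ioo,
      setIntegral_congr_fun measurableSet_Ioo hzero]
    simp
  have hright : ∫ s in t..x, w s * truncPow k s t = ∫ s in t..x, w s * (s - t) ^ k :=
    intervalIntegral.integral_congr fun s hs => by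
      rw [uIcc_of_le htx] at hs
      simp only [truncPow_of_le hs.1]
  have h1 : IntervalIntegrable (fun s => w s * truncPow k s t) volume a t := by
    rw [intervalIntegrable_iff_integrableOn_Ioo_of_le hat]
    exact (integrableOn_zero).congr_fun (fun s hs => (hzero s hs).symm) measurableSet_Ioo
  have h2 : IntervalIntegrable (fun s => w s * truncPow k s t) volume t x := by
    have h3 : IntervalIntegrable (fun s => w s * (s - t) ^ k) volume t x :=
      (hw.mono_set (by rw [uIcc_of_le htx, uIcc_of_le (hat.trans htx)]
                       exact Icc_subset_Icc_left hat)).mul_continuousOn (by fun_prop)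
    rw [intervalIntegrable_iff_integrableOn_Ioc_of_le htx] at h3 ⊢
    exact h3.congr_fun (fun s hs => by simp only [truncPow_of_le hs.1.le]) measurableSet_Ioc
  rw [← intervalIntegral.integral_add_adjacent_intervals h1 h2, hleft, hright, zero_add]

/-- Integrating a truncated power in its base point raises the exponent. -/
lemma integral_truncPow {k : ℕ} {a x t : ℝ} (hat : a ≤ t) (hax : a ≤ x) :
    ∫ s in a..x, truncPow k s t = truncPow (k + 1) x t / (k + 1) := by
  rcases le_or_gt t x with h | h
  · have := integral_mul_truncPow (k := k) (fun _ => 1) hat h (by simp)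
    simp only [one_mul] at this
    rw [this, truncPow_of_le h, intervalIntegral.integral_comp_sub_right (fun s => s ^ k)]
    simp
  · rw [truncPow_of_lt h, zero_div, intervalIntegral.integral_of_le hax]
    rw [setIntegral_congr_fun measurableSet_Ioc
      (fun s hs => truncPow_of_lt (hs.2.trans_lt h) : EqOn _ (fun _ => (0 : ℝ)) _)]
    simp

section Moments

variable {a b : ℝ} {ρ : Measure ℝ} [IsFiniteMeasure ρ]

lemma integrable_truncPow (hab : a ≤ b) (hρ : ∀ᵐ t ∂ρ, t ∈ Ioc a b) {x : ℝ} (hx : x ≤ b)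
    (k : ℕ) : Integrable (truncPow k x) ρ :=
  Integrable.of_bound (measurable_truncPow k x).aestronglyMeasurable ((b - a) ^ k)
    (hρ.mono fun _ ht => abs_truncPow_le hx ht.1.le hab)

lemma integrable_mul_truncPow_prod (hab : a ≤ b) (hρ : ∀ᵐ t ∂ρ, t ∈ Ioc a b) {x : ℝ}
    (hax : a ≤ x) (hx : x ≤ b) {w : ℝ → ℝ} (hw : IntervalIntegrable w volume a x) (k : ℕ) :
    Integrable (fun z : ℝ × ℝ => w z.1 * truncPow k z.1 z.2)
      ((volume.restrict (Ioc a x)).prod ρ) := by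
  rw [intervalIntegrable_iff_integrableOn_Ioc_of_le hax] at hw
  refine (hw.comp_fst ρ).mul_bdd (c := (b - a) ^ k)
    (measurable_truncPow_uncurry k).aestronglyMeasurable ?_
  rw [← Measure.restrict_eq_self_of_ae_mem hρ, Measure.prod_restrict]
  filter_upwards [ae_restrict_mem (measurableSet_Ioc.prod measurableSet_Ioc)] with z hz
  exact abs_truncPow_le (hz.1.2.trans hx) hz.2.1.le hab

/-- Fubini's theorem for the truncated power kernel. -/
lemma integral_integral_mul_truncPow (hab : a ≤ b) (hρ : ∀ᵐ t ∂ρ, t ∈ Ioc a b) {x : ℝ}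
    (hax : a ≤ x) (hx : x ≤ b) {w : ℝ → ℝ} (hw : IntervalIntegrable w volume a x) (k : ℕ) :
    ∫ s in a..x, w s * ∫ t, truncPow k s t ∂ρ =
      ∫ t, (∫ s in a..x, w s * truncPow k s t) ∂ρ := by
  simp_rw [intervalIntegral.integral_of_le hax, ← integral_const_mul]
  exact integral_integral_swap (integrable_mul_truncPow_prod hab hρ hax hx hw k)

lemma integrable_integral_mul_truncPow (hab : a ≤ b) (hρ : ∀ᵐ t ∂ρ, t ∈ Ioc a b) {x : ℝ}
    (hax : a ≤ x) (hx : x ≤ b) {w : ℝ → ℝ} (hw : IntervalIntegrable w volume a x) (k : ℕ) :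
    Integrable (fun t => ∫ s in a..x, w s * truncPow k s t) ρ := by
  simp_rw [intervalIntegral.integral_of_le hax]
  exact (integrable_mul_truncPow_prod hab hρ hax hx hw k).integral_prod_right

lemma intervalIntegrable_mul_integral_truncPow (hab : a ≤ b) (hρ : ∀ᵐ t ∂ρ, t ∈ Ioc a b)
    {x : ℝ} (hax : a ≤ x) (hx : x ≤ b) {w : ℝ → ℝ} (hw : IntervalIntegrable w volume a x)
    (k : ℕ) :
    IntervalIntegrable (fun s => w s * ∫ t, truncPow k s t ∂ρ) volume a x := by
  rw [intervalIntegrable_iff_integrableOn_Ioc_of_le hax]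
  simp_rw [← integral_const_mul]
  exact (integrable_mul_truncPow_prod hab hρ hax hx hw k).integral_prod_left

lemma integral_integral_truncPow (hab : a ≤ b) (hρ : ∀ᵐ t ∂ρ, t ∈ Ioc a b) {x : ℝ}
    (hax : a ≤ x) (hx : x ≤ b) (k : ℕ) :
    ∫ s in a..x, ∫ t, truncPow k s t ∂ρ = (∫ t, truncPow (k + 1) x t ∂ρ) / (k + 1) := by
  have h := integral_integral_mul_truncPow hab hρ hax hx (w := fun _ => 1) (by simp) k
  simp only [one_mul] at h
  rw [h, ← integral_div]
  exact integral_congr_ae (hρ.mono fun t ht => integral_truncPow ht.1.le hax)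

end Moments

/-- Iterated integrals of a distribution function are moments of truncated powers. -/
lemma iterInt_eq_integral_truncPow {a b : ℝ} (hab : a ≤ b) {P N : Measure ℝ}
    [IsFiniteMeasure P] [IsFiniteMeasure N] (hP : ∀ᵐ t ∂P, t ∈ Ioc a b)
    (hN : ∀ᵐ t ∂N, t ∈ Ioc a b) {F : ℝ → ℝ}
    (hF : ∀ x, F x = P.real (Ioc a x) - N.real (Ioc a x)) (k : ℕ) :
    ∀ x ∈ Icc a b, iterInt a F k x =
      ((∫ t, truncPow k x t ∂P) - ∫ t, truncPow k x t ∂N) / k.factorial := by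
  induction k with
  | zero =>
    intro x _
    have key : ∀ (ρ : Measure ℝ), (∀ᵐ t ∂ρ, t ∈ Ioc a b) →
        ∫ t, truncPow 0 x t ∂ρ = ρ.real (Ioc a x) := fun ρ hρ => by
      rw [← integral_indicator_one measurableSet_Ioc]
      refine integral_congr_ae (hρ.mono fun t ht => ?_)
      by_cases h : t ≤ x
      · simp [truncPow_of_le h, h, ht.1]
      · simp [truncPow, h]
    simp [iterInt, hF, key P hP, key N hN]
  | succ k ih =>
    intro x hx
    have hint : ∀ (ρ : Measure ℝ) [IsFiniteMeasure ρ], (∀ᵐ t ∂ρ, t ∈ Ioc a b) →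
        IntervalIntegrable (fun s => ∫ t, truncPow k s t ∂ρ) volume a x := fun ρ _ hρ => by
      simpa using intervalIntegrable_mul_integral_truncPow hab hρ hx.1 hx.2
        (w := fun _ => 1) (by simp) k
    have hcongr : iterInt a F (k + 1) x = ∫ s in a..x,
        ((∫ t, truncPow k s t ∂P) - ∫ t, truncPow k s t ∂N) / k.factorial :=
      intervalIntegral.integral_congr fun s hs => by
        rw [uIcc_of_le hx.1] at hs
        exact ih s ⟨hs.1, hs.2.trans hx.2⟩
    rw [hcongr, intervalIntegral.integral_div, intervalIntegral.integral_sub (hint P hP)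
      (hint N hN), integral_integral_truncPow hab hP hx.1 hx.2,
      integral_integral_truncPow hab hN hx.1 hx.2, Nat.factorial_succ]
    push_cast
    field_simp

/-- Taylor's formula with integral remainder, expanded at the right endpoint. -/
lemma taylor_integral_remainder_right {a b : ℝ} (n : ℕ) {H : ℕ → ℝ → ℝ}
    (hH : ∀ k ≤ n, ∀ t ∈ Icc a b, HasDerivAt (H k) (H (k + 1) t) t)
    (hc : ContinuousOn (H (n + 1)) (Icc a b)) {t : ℝ} (ht : t ∈ Icc a b) :
    H 0 t = ∑ k ∈ Finset.range (n + 1), H k b * ((t - b) ^ k / k.factorial) -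
      ∫ x in t..b, H (n + 1) x * ((t - x) ^ n / n.factorial) := by
  have hsub : uIcc t b ⊆ Icc a b := by
    rw [uIcc_of_le ht.2]; exact Icc_subset_Icc_left ht.1
  induction n with
  | zero =>
    have := intervalIntegral.integral_eq_sub_of_hasDerivAt
      (fun x hx => hH 0 le_rfl x (hsub hx)) ((hc.mono hsub).intervalIntegrable)
    simp only [zero_add] at this
    simp [this]
  | succ n ih =>
    have hc' : ContinuousOn (H (n + 1)) (Icc a b) := fun x hx =>
      (hH (n + 1) le_rfl x hx).continuousAt.continuousWithinAt
    have hv : ∀ x ∈ uIcc t b, HasDerivAt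
        (fun x => -((t - x) ^ (n + 1) / ((n + 1).factorial : ℝ)))
        ((t - x) ^ n / n.factorial) x := fun x _ => by
      have h1 := ((((hasDerivAt_id x).const_sub t).pow (n + 1)).div_const
        ((n + 1).factorial : ℝ)).neg
      refine h1.congr_deriv ?_
      rw [Nat.factorial_succ]
      push_cast
      simp only [id]
      field_simp
    have hparts := intervalIntegral.integral_mul_deriv_eq_deriv_mul
      (fun x hx => hH (n + 1) le_rfl x (hsub hx)) hv ((hc.mono hsub).intervalIntegrable)
      (Continuous.intervalIntegrable (by fun_prop) _ _)
    rw [ih (fun k hk => hH k (by omega)) hc', hparts, Finset.sum_range_succ _ (n + 1)]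
    simp only [mul_neg, intervalIntegral.integral_neg]
    simp
    ring

/-- Integrated Taylor formula against a finite measure on `(a, b]`. -/
lemma integral_eq_sum_add_integral_truncPow {a b : ℝ} (hab : a ≤ b) {ρ : Measure ℝ}
    [IsFiniteMeasure ρ] (hρ : ∀ᵐ t ∂ρ, t ∈ Ioc a b) (n : ℕ) {H : ℕ → ℝ → ℝ}
    (hH : ∀ k ≤ n, ∀ t ∈ Icc a b, HasDerivAt (H k) (H (k + 1) t) t)
    (hc : ContinuousOn (H (n + 1)) (Icc a b)) :
    ∫ t, H 0 t ∂ρ =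
      ∑ k ∈ Finset.range (n + 1),
        (H k b * (-1) ^ k / k.factorial) * ∫ t, truncPow k b t ∂ρ +
      (-1) ^ (n + 1) / n.factorial *
        ∫ x in a..b, H (n + 1) x * ∫ t, truncPow n x t ∂ρ := by
  have hw : IntervalIntegrable (H (n + 1)) volume a b := hc.intervalIntegrable_of_Icc hab
  have hpt : ∀ᵐ t ∂ρ, H 0 t =
      ∑ k ∈ Finset.range (n + 1), (H k b * (-1) ^ k / k.factorial) * truncPow k b t +
      (-1) ^ (n + 1) / n.factorial * ∫ x in a..b, H (n + 1) x * truncPow n x t := by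
    filter_upwards [hρ] with t ht
    rw [taylor_integral_remainder_right n hH hc ⟨ht.1.le, ht.2⟩,
      integral_mul_truncPow _ ht.1.le ht.2 hw, ← intervalIntegral.integral_const_mul,
      sub_eq_add_neg, ← intervalIntegral.integral_neg]
    congr 1
    · refine Finset.sum_congr rfl fun k _ => ?_
      rw [truncPow_of_le ht.2, ← neg_sub b t, neg_pow]
      ring
    · refine intervalIntegral.integral_congr fun x _ => ?_
      rw [← neg_sub x t, neg_pow]
      ring
  rw [integral_congr_ae hpt, integral_add, integral_finsetSum, integral_const_mul,
    integral_integral_mul_truncPow hab hρ hab le_rfl hw]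
  · simp_rw [integral_const_mul]
  · exact fun k _ => (integrable_truncPow hab hρ le_rfl k).const_mul _
  · exact integrable_finsetSum _ fun k _ => (integrable_truncPow hab hρ le_rfl k).const_mul _
  · exact (integrable_integral_mul_truncPow hab hρ hab le_rfl hw n).const_mul _

/-- The inequality for functions with a continuous nonnegative derivative of order `n + 1`. -/
lemma integral_le_integral_of_moments {a b : ℝ} (hab : a ≤ b) {P N : Measure ℝ}
    [IsFiniteMeasure P] [IsFiniteMeasure N] (hP : ∀ᵐ t ∂P, t ∈ Ioc a b)
    (hN : ∀ᵐ t ∂N, t ∈ Ioc a b) (n : ℕ)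
    (hb : ∀ k ≤ n, ∫ t, truncPow k b t ∂P = ∫ t, truncPow k b t ∂N)
    (hpos : ∀ x ∈ Ioo a b,
      0 ≤ (-1 : ℝ) ^ (n + 1) * ((∫ t, truncPow n x t ∂P) - ∫ t, truncPow n x t ∂N))
    {H : ℕ → ℝ → ℝ}
    (hH : ∀ k ≤ n, ∀ t ∈ Icc a b, HasDerivAt (H k) (H (k + 1) t) t)
    (hc : ContinuousOn (H (n + 1)) (Icc a b)) (hnn : ∀ t ∈ Icc a b, 0 ≤ H (n + 1) t) :
    ∫ t, H 0 t ∂N ≤ ∫ t, H 0 t ∂P := by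
  have hw : IntervalIntegrable (H (n + 1)) volume a b := hc.intervalIntegrable_of_Icc hab
  rw [integral_eq_sum_add_integral_truncPow hab hP n hH hc,
    integral_eq_sum_add_integral_truncPow hab hN n hH hc,
    Finset.sum_congr rfl fun k hk => by
      rw [← hb k (Nat.lt_succ_iff.mp (Finset.mem_range.mp hk))]]
  refine add_le_add le_rfl ?_
  rw [← sub_nonneg, ← mul_sub, ← intervalIntegral.integral_sub
    (intervalIntegrable_mul_integral_truncPow hab hP hab le_rfl hw n)
    (intervalIntegrable_mul_integral_truncPow hab hN hab le_rfl hw n),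
    ← intervalIntegral.integral_const_mul, intervalIntegral.integral_of_le hab,
    integral_Ioc_eq_integral_Ioo]
  refine setIntegral_nonneg measurableSet_Ioo fun x hx => ?_
  have h := mul_nonneg (hnn x ⟨hx.1.le, hx.2.le⟩) (hpos x hx)
  calc (0 : ℝ) ≤ H (n + 1) x * ((-1 : ℝ) ^ (n + 1) *
        ((∫ t, truncPow n x t ∂P) - ∫ t, truncPow n x t ∂N)) / n.factorial := by positivity
    _ = _ := by ring

/-- A chain of successive derivatives computes the iterated derivative. -/
lemma iteratedDerivWithin_eqOn_of_hasDerivAt {s : Set ℝ} (hs : IsOpen s) (m : ℕ)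
    {G : ℕ → ℝ → ℝ} (hG : ∀ k < m, ∀ x ∈ s, HasDerivAt (G k) (G (k + 1) x) x) :
    EqOn (iteratedDerivWithin m (G 0) s) (G m) s := by
  induction m with
  | zero => intro x _; simp
  | succ m ih =>
    intro x hx
    have ih' := ih fun k hk => hG k (hk.trans (Nat.lt_succ_self m))
    rw [iteratedDerivWithin_succ, derivWithin_congr ih' (ih' hx)]
    exact (hG m (Nat.lt_succ_self m) x hx).hasDerivWithinAt.derivWithin
      (hs.uniqueDiffOn x hx)

lemma contDiffOn_of_hasDerivAt {s : Set ℝ} (hs : IsOpen s) (m : ℕ)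
    {G : ℕ → ℝ → ℝ} (hG : ∀ k < m, ∀ x ∈ s, HasDerivAt (G k) (G (k + 1) x) x)
    (hc : ContinuousOn (G m) s) : ContDiffOn ℝ ((m : ℕ) : ℕ∞) (G 0) s := by
  have heq : ∀ k ≤ m, EqOn (iteratedDerivWithin k (G 0) s) (G k) s := fun k hk =>
    iteratedDerivWithin_eqOn_of_hasDerivAt hs k fun j hj => hG j (hj.trans_le hk)
  refine contDiffOn_of_continuousOn_differentiableOn_deriv (fun k hk => ?_) (fun k hk => ?_)
  · have hk' : k ≤ m := by exact_mod_cast hk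
    refine ContinuousOn.congr ?_ (heq k hk')
    rcases hk'.eq_or_lt with rfl | hlt
    · exact hc
    · exact fun x hx => (hG k hlt x hx).continuousAt.continuousWithinAt
  · have hk' : k < m := by exact_mod_cast hk
    exact DifferentiableOn.congr
      (fun x hx => (hG k hk' x hx).differentiableAt.differentiableWithinAt) (heq k hk'.le)

lemma nConvexOn_of_hasDerivAt {a b : ℝ} (m : ℕ) {G : ℕ → ℝ → ℝ}
    (hG : ∀ k < m, ∀ x ∈ Ioo a b, HasDerivAt (G k) (G (k + 1) x) x)
    (hconv : ConvexOn ℝ (Ioo a b) (G m)) : NConvexOn (m + 1) a b (G 0) :=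
  ⟨contDiffOn_of_hasDerivAt isOpen_Ioo m hG (hconv.continuousOn isOpen_Ioo),
    hconv.congr fun _ hx => (iteratedDerivWithin_eqOn_of_hasDerivAt isOpen_Ioo m hG hx).symm⟩

/-- Scaled powers of degree at most `n` are `n`-convex. -/
lemma nConvexOn_const_mul_sub_pow {a b : ℝ} (m : ℕ) {k : ℕ} (hk : k ≤ m + 1) (ε : ℝ) :
    NConvexOn (m + 1) a b fun t => ε * (b - t) ^ k := by
  have h := nConvexOn_of_hasDerivAt (a := a) (b := b) m
    (G := fun j t => ε * (-1) ^ j * k.descFactorial j * (b - t) ^ (k - j)) ?_ ?_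
  · simpa using h
  · intro j _ x _
    refine ((((hasDerivAt_id x).const_sub b).pow (k - j)).const_mul _).congr_deriv ?_
    rw [Nat.descFactorial_succ, Nat.sub_sub]
    push_cast
    simp only [id]
    ring
  · have hle : k - m = 0 ∨ k - m = 1 := by omega
    refine ⟨convex_Ioo a b, fun x _ y _ p q _ _ hpq => le_of_eq ?_⟩
    rcases hle with h | h
    · simp only [h, pow_zero, mul_one, smul_eq_mul]
      rw [← add_mul, hpq, one_mul]
    · simp only [h, pow_one, smul_eq_mul]
      obtain rfl : q = 1 - p := by linarith
      ring

lemma continuous_truncPow_succ (k : ℕ) (x : ℝ) : Continuous (truncPow (k + 1) x) := by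
  rw [funext (truncPow_succ_eq_max k x)]
  fun_prop

lemma hasDerivAt_truncPow (k : ℕ) (x t : ℝ) :
    HasDerivAt (truncPow (k + 2) x) (-(k + 2) * truncPow (k + 1) x t) t := by
  have hne : ∀ s ≠ x, HasDerivAt (truncPow (k + 2) x) (-(k + 2) * truncPow (k + 1) x s) s := by
    intro s hs
    rcases hs.lt_or_gt with h | h
    · have h1 := ((hasDerivAt_id s).const_sub x).pow (k + 2)
      refine (h1.congr_of_eventuallyEq ?_).congr_deriv ?_
      · filter_upwards [Iio_mem_nhds h] with u hu
        simp [truncPow_of_le (le_of_lt hu)]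
      · rw [truncPow_of_le h.le]
        simp
        ring
    · rw [truncPow_of_lt h, mul_zero]
      refine (hasDerivAt_const s (0 : ℝ)).congr_of_eventuallyEq ?_
      filter_upwards [Ioi_mem_nhds h] with u hu
      exact truncPow_of_lt hu
  rcases eq_or_ne t x with rfl | h
  · exact hasDerivAt_of_hasDerivAt_of_ne
      (g := fun s => -((k : ℝ) + 2) * truncPow (k + 1) t s) hne
      (continuous_truncPow_succ (k + 1) t).continuousAt
      ((continuous_truncPow_succ k t).const_mul _).continuousAt
  · exact hne t h

/-- Signed truncated powers of degree `n` are `n`-convex. -/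
lemma nConvexOn_truncPow {a b : ℝ} (m : ℕ) (x : ℝ) :
    NConvexOn (m + 1) a b fun t => (-1) ^ (m + 2) * truncPow (m + 1) x t := by
  have h := nConvexOn_of_hasDerivAt (a := a) (b := b) m
    (G := fun j t => (-1) ^ (m + 2) * (-1) ^ j * (m + 1).descFactorial j *
      truncPow (m + 1 - j) x t) ?_ ?_
  · simpa using h
  · intro j hj t _
    obtain ⟨i, rfl⟩ := Nat.exists_eq_add_of_lt hj
    have h1 : j + i + 1 + 1 - j = i + 2 := by omega
    have h2 : j + i + 1 + 1 - (j + 1) = i + 1 := by omega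
    simp only [h1, h2]
    refine ((hasDerivAt_truncPow i x t).const_mul _).congr_deriv ?_
    rw [Nat.descFactorial_succ, h1]
    push_cast
    ring
  · have h1 : m + 1 - m = 0 + 1 := by omega
    simp only [h1, truncPow_succ_eq_max]
    have haff : ConvexOn ℝ (Ioo a b) fun t => x - t :=
      ⟨convex_Ioo a b, fun u _ v _ p q _ _ hpq => le_of_eq (by
        obtain rfl : q = 1 - p := by linarith
        simp only [smul_eq_mul]
        ring)⟩
    have hmax := haff.sup (convexOn_const 0 (convex_Ioo a b))
    have hsign : (0 : ℝ) ≤ (-1) ^ (m + 2) * (-1) ^ m * (m + 1).descFactorial m := by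
      rw [← pow_add, Even.neg_one_pow ⟨m + 1, by ring⟩, one_mul]
      positivity
    exact (hmax.smul hsign).congr fun t _ => by simp

/-- Second differences are values of the second derivative. -/
lemma exists_second_difference_eq {φ φ' φ'' : ℝ → ℝ} (h0 : ∀ x, HasDerivAt φ (φ' x) x)
    (h1 : ∀ x, HasDerivAt φ' (φ'' x) x) (y : ℝ) {h : ℝ} (hh : 0 < h) :
    ∃ c ∈ Icc y (y + 2 * h), φ (y + 2 * h) - 2 * φ (y + h) + φ y = h ^ 2 * φ'' c := by
  have hψ : ∀ x, HasDerivAt (fun s => φ (s + h) - φ s) (φ' (x + h) - φ' x) x := fun x =>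
    ((h0 (x + h)).comp_add_const x h).sub (h0 x)
  obtain ⟨u, hu, hu'⟩ := exists_hasDerivAt_eq_slope (fun s => φ (s + h) - φ s) _
    (show y < y + h by linarith) (fun x _ => (hψ x).continuousAt.continuousWithinAt)
    (fun x _ => hψ x)
  obtain ⟨c, hc, hc'⟩ := exists_hasDerivAt_eq_slope φ' _
    (show u < u + h by linarith) (fun x _ => (h1 x).continuousAt.continuousWithinAt)
    (fun x _ => h1 x)
  refine ⟨c, ⟨by linarith [hu.1, hc.1], by linarith [hu.2, hc.2]⟩, ?_⟩
  rw [hc', add_sub_cancel_left]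
  simp only [add_sub_cancel_left] at hu'
  rw [hu', show y + 2 * h = y + h + h by ring]
  field_simp
  ring

/-- The derivatives of an `n`-convex function, preceded by two antiderivatives. -/
lemma NConvexOn.exists_antiderivatives {a b : ℝ} (hab : a ≤ b) {m : ℕ} {f : ℝ → ℝ}
    (hf : ContinuousOn f (Icc a b)) (hconv : NConvexOn (m + 1) a b f) :
    ∃ G : ℕ → ℝ → ℝ, (∀ x, HasDerivAt (G 0) (G 1 x) x) ∧
      (∀ x, HasDerivAt (G 1) (IccExtend hab (domRestrict (Icc a b) f) x) x) ∧
      (∀ k < m + 2, ∀ x ∈ Ioo a b, HasDerivAt (G k) (G (k + 1) x) x) ∧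
      ConvexOn ℝ (Ioo a b) (G (m + 2)) := by
  set fe := IccExtend hab (domRestrict (Icc a b) f) with hfe
  have hfc : Continuous fe := (continuousOn_iff_continuous_domRestrict.mp hf).Icc_extend'
  have h1 : ∀ x, HasDerivAt (fun y => ∫ t in a..y, fe t) (fe x) x := fun x =>
    (hfc.integral_hasStrictDerivAt a x).hasDerivAt
  have hc1 : Continuous fun y => ∫ t in a..y, fe t :=
    continuous_iff_continuousAt.mpr fun x => (h1 x).continuousAt
  have h0 : ∀ x, HasDerivAt (fun z => ∫ y in a..z, ∫ t in a..y, fe t)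
      (∫ t in a..x, fe t) x := fun x => (hc1.integral_hasStrictDerivAt a x).hasDerivAt
  refine ⟨fun k => match k with
    | 0 => fun z => ∫ y in a..z, ∫ t in a..y, fe t
    | 1 => fun y => ∫ t in a..y, fe t
    | k + 2 => iteratedDerivWithin k f (Ioo a b), h0, h1, fun k hk x hx => ?_, hconv.2⟩
  match k, hk with
  | 0, _ => exact h0 x
  | 1, _ =>
    have : fe x = f x := IccExtend_of_mem hab _ (Ioo_subset_Icc_self hx)
    simpa [this] using h1 x
  | k + 2, hk =>
    have hd := hconv.1.differentiableOn_iteratedDerivWithin (m := k)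
      (by simp only [Nat.add_sub_cancel]; exact_mod_cast (by omega : k < m))
      isOpen_Ioo.uniqueDiffOn
    simp only [iteratedDerivWithin_succ]
    exact (hd x hx).hasDerivWithinAt.hasDerivAt (isOpen_Ioo.mem_nhds hx)

lemma ConvexOn.second_difference_nonneg {s : Set ℝ} {g : ℝ → ℝ} (hg : ConvexOn ℝ s g)
    {y h : ℝ} (hy : y ∈ s) (hy' : y + 2 * h ∈ s) :
    0 ≤ g (y + 2 * h) - 2 * g (y + h) + g y := by
  have := hg.2 hy hy' (by norm_num : (0 : ℝ) ≤ 1 / 2) (by norm_num : (0 : ℝ) ≤ 1 / 2)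
    (by norm_num)
  simp only [smul_eq_mul] at this
  rw [show 1 / 2 * y + 1 / 2 * (y + 2 * h) = y + h by ring] at this
  linarith

/-- Second differences of the double antiderivative, taken along a contraction of `[a, b]` into
its interior, give functions `n + 1` times differentiable with nonnegative last derivative that
are close to `f`. -/
lemma NConvexOn.exists_smooth_approx {a b : ℝ} (hab : a < b) {m : ℕ} {f : ℝ → ℝ}
    (hf : ContinuousOn f (Icc a b)) (hconv : NConvexOn (m + 1) a b f) {h : ℝ} (hh : 0 < h)
    (hh' : 4 * h < b - a) :
    ∃ H : ℕ → ℝ → ℝ, Continuous (H 0) ∧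
      (∀ k ≤ m + 1, ∀ t ∈ Icc a b, HasDerivAt (H k) (H (k + 1) t) t) ∧
      ContinuousOn (H (m + 2)) (Icc a b) ∧ (∀ t ∈ Icc a b, 0 ≤ H (m + 2) t) ∧
      ∀ t ∈ Icc a b, ∃ c ∈ Icc a b, |c - t| ≤ 3 * h ∧ H 0 t = f c := by
  obtain ⟨G, hG0, hG1, hG, hGc⟩ := hconv.exists_antiderivatives hab.le hf
  set r := 1 - 4 * h / (b - a) with hr
  have hba : 0 < b - a := by linarith
  have hq : 0 < 4 * h / (b - a) := by positivity
  have hr0 : 0 < r := by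
    rw [hr, sub_pos, div_lt_one hba]; exact hh'
  have hr1 : r * (b - a) = b - a - 4 * h := by rw [hr]; field_simp
  set y : ℝ → ℝ := fun t => a + h + r * (t - a) with hy
  have hyc : Continuous y := by fun_prop
  have hy_lower : ∀ t ∈ Icc a b, a + h ≤ y t := fun t ht => by
    have := mul_nonneg hr0.le (sub_nonneg.mpr ht.1)
    simp only [hy]; linarith
  have hy_upper : ∀ t ∈ Icc a b, y t + 2 * h ≤ b - h := fun t ht => by
    have := mul_le_mul_of_nonneg_left (sub_le_sub_right ht.2 a) hr0.le
    simp only [hy]; linarith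
  have hy_near : ∀ t ∈ Icc a b, t - 3 * h ≤ y t ∧ y t ≤ t + h := fun t ht => by
    have h1 : 4 * h / (b - a) * (t - a) ≤ 4 * h := by
      rw [div_mul_eq_mul_div, div_le_iff₀ hba]
      exact mul_le_mul_of_nonneg_left (sub_le_sub_right ht.2 a) (by positivity)
    have h2 : 0 ≤ 4 * h / (b - a) * (t - a) := mul_nonneg hq.le (sub_nonneg.mpr ht.1)
    have h3 : y t = t + h - 4 * h / (b - a) * (t - a) := by simp only [hy, hr]; ring
    constructor <;> linarith
  have hm0 : ∀ t ∈ Icc a b, y t ∈ Ioo a b := fun t ht =>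
    ⟨by linarith [hy_lower t ht], by linarith [hy_upper t ht]⟩
  have hm1 : ∀ t ∈ Icc a b, y t + h ∈ Ioo a b := fun t ht =>
    ⟨by linarith [hy_lower t ht], by linarith [hy_upper t ht]⟩
  have hm2 : ∀ t ∈ Icc a b, y t + 2 * h ∈ Ioo a b := fun t ht =>
    ⟨by linarith [hy_lower t ht], by linarith [hy_upper t ht]⟩
  have hG0c : Continuous (G 0) :=
    continuous_iff_continuousAt.mpr fun x => (hG0 x).continuousAt
  have hGcc : ContinuousOn (G (m + 2)) (Ioo a b) := hGc.continuousOn isOpen_Ioo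
  have hyd : ∀ t d, HasDerivAt (fun s => y s + d) r t := fun t d => by
    simpa [hy] using ((((hasDerivAt_id t).sub_const a).const_mul r).const_add (a + h)).add_const d
  refine ⟨fun k t => r ^ k / h ^ 2 *
    (G k (y t + 2 * h) - 2 * G k (y t + h) + G k (y t)), by fun_prop, fun k hk t ht => ?_,
    ?_, fun t ht => ?_, fun t ht => ?_⟩
  · have hd0 := (hG k (by omega) _ (hm0 t ht)).comp t (by simpa using hyd t 0)
    have hd1 := (hG k (by omega) _ (hm1 t ht)).comp t (hyd t h)
    have hd2 := (hG k (by omega) _ (hm2 t ht)).comp t (hyd t (2 * h))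
    refine (((hd2.sub (hd1.const_mul 2)).add hd0).const_mul (r ^ k / h ^ 2)).congr_deriv ?_
    ring
  · exact (((hGcc.comp (by fun_prop) hm2).sub
      ((hGcc.comp (by fun_prop) hm1).const_smul (2 : ℝ))).add
      (hGcc.comp hyc.continuousOn hm0)).const_smul (r ^ (m + 2) / h ^ 2)
  · exact mul_nonneg (by positivity) (hGc.second_difference_nonneg (hm0 t ht) (hm2 t ht))
  · obtain ⟨c, hc, hc'⟩ := exists_second_difference_eq hG0 hG1 (y t) hh
    have hcm : c ∈ Icc a b :=
      ⟨(hm0 t ht).1.le.trans hc.1, hc.2.trans (hm2 t ht).2.le⟩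
    refine ⟨c, hcm, abs_le.mpr ⟨?_, ?_⟩, ?_⟩
    · linarith [hc.1, (hy_near t ht).1]
    · linarith [hc.2, (hy_near t ht).2]
    · simp only [hc', IccExtend_of_mem hab.le _ hcm, domRestrict_apply]
      field_simp

lemma NConvexOn.integral_le_integral {a b : ℝ} (hab : a < b) {P N : Measure ℝ}
    [IsFiniteMeasure P] [IsFiniteMeasure N] (hP : ∀ᵐ t ∂P, t ∈ Ioc a b)
    (hN : ∀ᵐ t ∂N, t ∈ Ioc a b) (m : ℕ)
    (hb : ∀ k ≤ m + 1, ∫ t, truncPow k b t ∂P = ∫ t, truncPow k b t ∂N)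
    (hpos : ∀ x ∈ Ioo a b, 0 ≤ (-1 : ℝ) ^ (m + 1 + 1) *
      ((∫ t, truncPow (m + 1) x t ∂P) - ∫ t, truncPow (m + 1) x t ∂N))
    {f : ℝ → ℝ} (hf : ContinuousOn f (Icc a b)) (hconv : NConvexOn (m + 1) a b f) :
    ∫ t, f t ∂N ≤ ∫ t, f t ∂P := by
  set h : ℕ → ℝ := fun j => (b - a) / 5 * (1 / (j + 1)) with hh
  have hba : 0 < b - a := by linarith
  have hh0 : ∀ j, 0 < h j := fun j => by positivity
  have hh1 : ∀ j, 4 * h j < b - a := fun j => by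
    have : 1 / ((j : ℝ) + 1) ≤ 1 := by
      rw [div_le_one (by positivity)]; linarith [(Nat.cast_nonneg j : (0 : ℝ) ≤ j)]
    have := mul_le_mul_of_nonneg_left this (by positivity : 0 ≤ (b - a) / 5)
    simp only [hh]; linarith
  have hlim : Filter.Tendsto h Filter.atTop (nhds 0) := by
    simpa [hh] using tendsto_one_div_add_atTop_nhds_zero_nat.const_mul ((b - a) / 5)
  choose H hHcont hHder hHc hHnn hHapp using fun j =>
    hconv.exists_smooth_approx hab hf (hh0 j) (hh1 j)
  obtain ⟨C, hC⟩ := isCompact_Icc.exists_bound_of_continuousOn hf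
  have hconvg : ∀ (ρ : Measure ℝ) [IsFiniteMeasure ρ], (∀ᵐ t ∂ρ, t ∈ Ioc a b) →
      Filter.Tendsto (fun j => ∫ t, H j 0 t ∂ρ) Filter.atTop (nhds (∫ t, f t ∂ρ)) := by
    intro ρ _ hρ
    refine tendsto_integral_of_dominated_convergence (fun _ => C)
      (fun j => (hHcont j).aestronglyMeasurable) (integrable_const C) (fun j => ?_) ?_
    · filter_upwards [hρ] with t ht
      obtain ⟨c, hc, -, hc'⟩ := hHapp j t (Ioc_subset_Icc_self ht)
      rw [hc']
      exact hC c hc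
    · filter_upwards [hρ] with t ht
      have ht' := Ioc_subset_Icc_self ht
      choose c hc hct hcf using fun j => hHapp j t ht'
      simp_rw [hcf]
      refine (hf t ht').tendsto.comp (tendsto_nhdsWithin_iff.mpr
        ⟨?_, Filter.Eventually.of_forall hc⟩)
      rw [tendsto_iff_dist_tendsto_zero]
      refine squeeze_zero (fun _ => dist_nonneg) (fun j => (hct j : dist (c j) t ≤ _)) ?_
      simpa using hlim.const_mul 3
  exact le_of_tendsto_of_tendsto' (hconvg N hN) (hconvg P hP) fun j =>
    integral_le_integral_of_moments hab.le hP hN (m + 1) hb hpos (hHder j) (hHc j) (hHnn j)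

lemma ConcentratedOn.ae_mem {μ : SignedMeasure ℝ} {s : Set ℝ} (h : ConcentratedOn μ s) :
    (∀ᵐ t ∂μ.toJordanDecomposition.posPart, t ∈ s) ∧
      ∀ᵐ t ∂μ.toJordanDecomposition.negPart, t ∈ s := by
  simp only [ConcentratedOn, SignedMeasure.totalVariation, Measure.coe_add, Pi.add_apply,
    add_eq_zero] at h
  exact h

lemma signedMeasure_apply_eq_sub (μ : SignedMeasure ℝ) {s : Set ℝ} (hs : MeasurableSet s) :
    μ s = μ.toJordanDecomposition.posPart.real s - μ.toJordanDecomposition.negPart.real s := by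
  conv_lhs => rw [← μ.toSignedMeasure_toJordanDecomposition]
  rw [JordanDecomposition.toSignedMeasure, Measure.toSignedMeasure_sub_apply hs]

lemma ConcentratedOn.sintegralOn_eq {μ : SignedMeasure ℝ} {s t : Set ℝ}
    (h : ConcentratedOn μ s) (hst : s ⊆ t) (f : ℝ → ℝ) :
    sintegralOn μ t f = (∫ x, f x ∂μ.toJordanDecomposition.posPart) -
      ∫ x, f x ∂μ.toJordanDecomposition.negPart := by
  rw [sintegralOn, Measure.restrict_eq_self_of_ae_mem (h.ae_mem.1.mono fun _ hx => hst hx),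
    Measure.restrict_eq_self_of_ae_mem (h.ae_mem.2.mono fun _ hx => hst hx)]

/-- **Lemma 2.3.** For a signed measure `μ` concentrated on `(a,b]` with distribution
function `F`, the inequality `∫_{[a,b]} f dμ ≥ 0` holds for all continuous `n`-convex
functions `f` iff `F(b) = 0`, `I₁(b) = 0`, `I_k(b) = 0` for `k = 2,…,n`, and
`(−1)^{n+1} I_n(x) ≥ 0` on `(a,b)`. -/
theorem statement4 (a b : ℝ) (hab : a < b) (n : ℕ) (hn : 1 ≤ n)
    (μ : SignedMeasure ℝ) (hμ : ConcentratedOn μ (Ioc a b))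
    (F : ℝ → ℝ) (hF : ∀ x, F x = μ (Ioc a x)) :
    (∀ f : ℝ → ℝ, ContinuousOn f (Icc a b) → NConvexOn n a b f →
        0 ≤ sintegralOn μ (Icc a b) f) ↔
      (F b = 0 ∧
        iterInt a F 1 b = 0 ∧
        (∀ k, 2 ≤ k → k ≤ n → iterInt a F k b = 0) ∧
        (∀ x ∈ Ioo a b, 0 ≤ (-1 : ℝ) ^ (n + 1) * iterInt a F n x)) := by
  obtain ⟨m, rfl⟩ := Nat.exists_eq_add_of_le' hn
  obtain ⟨hP, hN⟩ := hμ.ae_mem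
  simp only [hμ.sintegralOn_eq Ioc_subset_Icc_self]
  have hI := iterInt_eq_integral_truncPow hab.le hP hN
    (fun x => (hF x).trans (signedMeasure_apply_eq_sub μ measurableSet_Ioc))
  set P := μ.toJordanDecomposition.posPart
  set N := μ.toJordanDecomposition.negPart
  have hbmem : b ∈ Icc a b := right_mem_Icc.mpr hab.le
  constructor
  · intro hineq
    have hzero : ∀ k ≤ m + 1, iterInt a F k b = 0 := by
      intro k hk
      have hpow : ∀ ρ : Measure ℝ, (∀ᵐ t ∂ρ, t ∈ Ioc a b) →
          ∫ t, truncPow k b t ∂ρ = ∫ t, (b - t) ^ k ∂ρ := fun ρ hρ =>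
        integral_congr_ae (hρ.mono fun t ht => truncPow_of_le ht.2)
      have hp := hineq _ (by fun_prop) (nConvexOn_const_mul_sub_pow (a := a) (b := b) m hk 1)
      have hm := hineq _ (by fun_prop)
        (nConvexOn_const_mul_sub_pow (a := a) (b := b) m hk (-1))
      simp only [integral_const_mul] at hp hm
      rw [hI k b hbmem, hpow P hP, hpow N hN, div_eq_zero_iff]
      left
      linarith
    refine ⟨hzero 0 (by omega), hzero 1 (by omega), fun k _ hk => hzero k hk, fun x hx => ?_⟩
    have h := hineq _ ((continuous_truncPow_succ m x).const_mul _).continuousOn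
      (nConvexOn_truncPow (a := a) (b := b) m x)
    simp only [integral_const_mul, ← mul_sub] at h
    rw [hI (m + 1) x (Ioo_subset_Icc_self hx), mul_div_assoc']
    exact div_nonneg h (by positivity)
  · rintro ⟨h0, h1, h2, hpos⟩ f hf hconv
    refine sub_nonneg.mpr (hconv.integral_le_integral hab hP hN m (fun k hk => ?_)
      (fun x hx => ?_) hf)
    · have hk0 : iterInt a F k b = 0 := by
        rcases k with _ | _ | k
        · exact h0
        · exact h1
        · exact h2 _ (by omega) hk
      rw [hI k b hbmem, div_eq_zero_iff] at hk0
      exact sub_eq_zero.mp (hk0.resolve_right (by positivity))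
    · have h := hpos x hx
      rw [hI (m + 1) x (Ioo_subset_Icc_self hx), mul_div_assoc'] at h
      exact (le_div_iff₀ (by positivity)).mp h |>.trans_eq' (by simp)
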